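/- arXiv:math/0512438 — 6 statements merged into one kernel-verified Lean document; each statement's English description precedes it below -/
import Mathlib

section
/- Let Λ be a row-finite locally convex k-graph and {s_λ : λ ∈ Λ} a Cuntz–Krieger Λ-family in a C*-algebra A. Suppose λ is a loop with an entrance: r(λ) = s(λ), d(λ) ≥ e_i for some 1 ≤ i ≤ k, and there is e ∈ Λ^{e_i} with r(e) = r(λ) and e ≠ λ(0,e_i), where λ(0,e_i) denotes the unique initial segment of λ of degree e_i provided by the factorisation property. Then every trace τ on A with τ(p_{r(λ)}) < ∞ satisfies τ(s_e* s_e) = τ(s_e s_e*) = 0. In particular, if τ is a faithful trace on A with τ(p_{r(λ)}) < ∞, then s_e = 0. -/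
open scoped BigOperators ENNReal NNReal

/-- A `k`-graph: a countable small category `Λ` together with a degree functor
`d : Λ → ℕ^k` satisfying the factorisation property.  Objects are identified with
the identity morphisms, i.e. the paths of degree `0`. -/
structure KGraph (k : ℕ) where
  /-- The morphisms ("paths") of the category. -/
  Path : Type
  countable : Countable Path
  /-- The degree functor. -/
  d : Path → Fin k → ℕ
  /-- The range (codomain) of a path, as an identity morphism. -/
  r : Path → Path
  /-- The source (domain) of a path, as an identity morphism. -/
  s : Path → Path
  /-- Composition `μν` of paths with `s μ = r ν`. -/
  comp : (μ ν : Path) → s μ = r ν → Path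
  d_r : ∀ lam : Path, d (r lam) = 0
  d_s : ∀ lam : Path, d (s lam) = 0
  /-- Paths of degree zero are identity morphisms, identified with their range. -/
  vertex_r : ∀ v : Path, d v = 0 → r v = v
  vertex_s : ∀ v : Path, d v = 0 → s v = v
  r_comp : ∀ (μ ν : Path) (h : s μ = r ν), r (comp μ ν h) = r μ
  s_comp : ∀ (μ ν : Path) (h : s μ = r ν), s (comp μ ν h) = s ν
  d_comp : ∀ (μ ν : Path) (h : s μ = r ν), d (comp μ ν h) = d μ + d ν
  comp_assoc : ∀ (lam μ ν : Path) (h₁ : s lam = r μ) (h₂ : s μ = r ν)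
      (h₃ : s (comp lam μ h₁) = r ν) (h₄ : s lam = r (comp μ ν h₂)),
      comp (comp lam μ h₁) ν h₃ = comp lam (comp μ ν h₂) h₄
  id_comp : ∀ (lam : Path) (h : s (r lam) = r lam), comp (r lam) lam h = lam
  comp_id : ∀ (lam : Path) (h : s lam = r (s lam)), comp lam (s lam) h = lam
  /-- The factorisation property. -/
  factor : ∀ (lam : Path) (m n : Fin k → ℕ), d lam = m + n →
      ∃! p : Path × Path, ∃ h : s p.1 = r p.2,
        d p.1 = m ∧ d p.2 = n ∧ comp p.1 p.2 h = lam

namespace KGraph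

variable {k : ℕ} (Λ : KGraph k)

/-- A vertex is a path of degree `0`. -/
def IsVertex (v : Λ.Path) : Prop := Λ.d v = 0

/-- The set `vΛⁿ` of paths of degree `n` with range `v`. -/
def paths (v : Λ.Path) (n : Fin k → ℕ) : Set Λ.Path :=
  {lam | Λ.d lam = n ∧ Λ.r lam = v}

/-- The set `Λⁿv` of paths of degree `n` with source `v`. -/
def pathsTo (v : Λ.Path) (n : Fin k → ℕ) : Set Λ.Path :=
  {lam | Λ.d lam = n ∧ Λ.s lam = v}

/-- The set `Λ^{≤ n}`. -/
def lePaths (n : Fin k → ℕ) : Set Λ.Path :=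
  {lam | Λ.d lam ≤ n ∧
    ∀ (μ : Λ.Path) (_ : Λ.s lam = Λ.r μ), Λ.d lam + Λ.d μ ≤ n → μ = Λ.s lam}

/-- The set `vΛ^{≤ n}`. -/
def vLePaths (v : Λ.Path) (n : Fin k → ℕ) : Set Λ.Path :=
  {lam | lam ∈ Λ.lePaths n ∧ Λ.r lam = v}

/-- `Λ` is row-finite if each `vΛⁿ` is finite. -/
def RowFinite : Prop := ∀ (v : Λ.Path) (n : Fin k → ℕ), (Λ.paths v n).Finite

/-- `Λ` is locally finite if it is row-finite and each `Λⁿv` is finite. -/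
def LocallyFinite : Prop :=
  Λ.RowFinite ∧ ∀ (v : Λ.Path) (n : Fin k → ℕ), (Λ.pathsTo v n).Finite

/-- `Λ` has no sinks if each `Λⁿv` is nonempty. -/
def NoSinks : Prop :=
  ∀ (v : Λ.Path), Λ.IsVertex v → ∀ n : Fin k → ℕ, (Λ.pathsTo v n).Nonempty

/-- `Λ` has no sources if each `vΛⁿ` is nonempty. -/
def NoSources : Prop :=
  ∀ (v : Λ.Path), Λ.IsVertex v → ∀ n : Fin k → ℕ, (Λ.paths v n).Nonempty

/-- `Λ` is locally convex. -/
def LocallyConvex : Prop :=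
  ∀ (i j : Fin k), i ≠ j → ∀ e : Λ.Path, Λ.d e = Pi.single i 1 →
    Λ.paths (Λ.s e) (Pi.single j 1) = ∅ → Λ.paths (Λ.r e) (Pi.single j 1) = ∅

/-- A `k`-graph trace on `Λ`: a function `g : Λ⁰ → [0,∞)` (extended arbitrarily to
all paths) with `g v = Σ_{λ ∈ vΛ^{≤n}} g (s λ)` for every vertex `v` and `n ∈ ℕ^k`. -/
def IsGraphTrace (g : Λ.Path → ℝ) : Prop :=
  (∀ v : Λ.Path, Λ.IsVertex v → 0 ≤ g v) ∧
  ∀ (v : Λ.Path), Λ.IsVertex v → ∀ (n : Fin k → ℕ) (F : Finset Λ.Path),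
    ↑F = Λ.vLePaths v n → g v = ∑ lam ∈ F, g (Λ.s lam)

/-- Two paths are orthogonal if they have no common extension. -/
def Orthogonal (μ ν : Λ.Path) : Prop :=
  ¬ ∃ (α β : Λ.Path) (h₁ : Λ.s μ = Λ.r α) (h₂ : Λ.s ν = Λ.r β),
      Λ.comp μ α h₁ = Λ.comp ν β h₂

end KGraph

/-- A boundary path of degree `m ∈ (ℕ ∪ {∞})^k` in a `k`-graph `Λ`. -/
structure KGraph.BoundaryPath {k : ℕ} (Λ : KGraph k) where
  /-- The degree of the boundary path. -/
  deg : Fin k → ℕ∞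
  /-- The segment `x(p,q)` for `p ≤ q ≤ deg`. -/
  seg : (Fin k → ℕ) → (Fin k → ℕ) → Λ.Path
  seg_d : ∀ p q : Fin k → ℕ, p ≤ q → (∀ i, (q i : ℕ∞) ≤ deg i) →
    Λ.d (seg p q) = q - p
  seg_r : ∀ p q : Fin k → ℕ, p ≤ q → (∀ i, (q i : ℕ∞) ≤ deg i) →
    Λ.r (seg p q) = seg p p
  seg_s : ∀ p q : Fin k → ℕ, p ≤ q → (∀ i, (q i : ℕ∞) ≤ deg i) →
    Λ.s (seg p q) = seg q q
  seg_comp : ∀ p q t : Fin k → ℕ, p ≤ q → q ≤ t → (∀ i, (t i : ℕ∞) ≤ deg i) →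
    ∀ h : Λ.s (seg p q) = Λ.r (seg q t), Λ.comp (seg p q) (seg q t) h = seg p t
  boundary : ∀ (i : Fin k) (n : Fin k → ℕ), (∀ j, (n j : ℕ∞) ≤ deg j) →
    (n i : ℕ∞) = deg i → Λ.paths (seg n n) (Pi.single i 1) = ∅

namespace KGraph

variable {k : ℕ} (Λ : KGraph k)

/-- An end of `Λ`: a boundary path `x` with `r(x)Λⁿ = {x(0,n)}` for all `n ≤ d(x)`. -/
def IsEnd (x : Λ.BoundaryPath) : Prop :=
  ∀ n : Fin k → ℕ, (∀ i, (n i : ℕ∞) ≤ x.deg i) →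
    Λ.paths (x.seg 0 0) n = {x.seg 0 n}

/-- A vertex `v` lies on the boundary path `x` if `v = x(n)` for some `n ≤ d(x)`. -/
def LiesOn (v : Λ.Path) (x : Λ.BoundaryPath) : Prop :=
  ∃ n : Fin k → ℕ, (∀ i, (n i : ℕ∞) ≤ x.deg i) ∧ v = x.seg n n

/-- Two ends are equivalent if they pass through a common vertex. -/
def EndEquiv (x y : Λ.BoundaryPath) : Prop :=
  ∃ (n m : Fin k → ℕ), (∀ i, (n i : ℕ∞) ≤ x.deg i) ∧ (∀ i, (m i : ℕ∞) ≤ y.deg i) ∧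
    x.seg n n = y.seg m m

end KGraph

/-- A Cuntz–Krieger `Λ`-family in a `C*`-algebra `A`. -/
structure CKFamily {k : ℕ} (Λ : KGraph k) (A : Type*) [NormedRing A] [StarRing A] where
  /-- The partial isometries `s_λ`. -/
  S : Λ.Path → A
  partial_isom : ∀ lam : Λ.Path, S lam * star (S lam) * S lam = S lam
  vertex_star : ∀ v : Λ.Path, Λ.IsVertex v → star (S v) = S v
  vertex_idem : ∀ v : Λ.Path, Λ.IsVertex v → S v * S v = S v
  vertex_orth : ∀ v w : Λ.Path, Λ.IsVertex v → Λ.IsVertex w → v ≠ w → S v * S w = 0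
  comp_mul : ∀ (μ ν : Λ.Path) (h : Λ.s μ = Λ.r ν), S μ * S ν = S (Λ.comp μ ν h)
  star_mul_self : ∀ lam : Λ.Path, star (S lam) * S lam = S (Λ.s lam)
  cuntz_krieger : ∀ (v : Λ.Path), Λ.IsVertex v → ∀ (n : Fin k → ℕ) (F : Finset Λ.Path),
    ↑F = Λ.vLePaths v n → S v = ∑ lam ∈ F, S lam * star (S lam)

/-- A trace on a `C*`-algebra `A`: a map `τ : A⁺ → [0,∞]` (extended arbitrarily to `A`)
which is additive and positively homogeneous on the positive cone and tracial. -/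
structure CstarTrace (A : Type*) [NormedRing A] [StarRing A] [PartialOrder A]
    [Module ℝ A] where
  /-- The underlying map. -/
  τ : A → ℝ≥0∞
  map_add : ∀ a b : A, 0 ≤ a → 0 ≤ b → τ (a + b) = τ a + τ b
  map_smul : ∀ (c : ℝ) (a : A), 0 ≤ c → 0 ≤ a → τ (c • a) = ENNReal.ofReal c * τ a
  tracial : ∀ a : A, τ (star a * a) = τ (a * star a)

namespace KGraph

variable {k : ℕ} {Λ : KGraph k}

theorem eq_r_of_d_eq_zero {μ : Λ.Path} (h : Λ.d μ = 0) : μ = Λ.r μ :=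
  (Λ.vertex_r μ h).symm

/-- Paths of degree exactly `n` belong to `Λ^{≤ n}`. -/
theorem paths_subset_vLePaths (v : Λ.Path) (n : Fin k → ℕ) :
    Λ.paths v n ⊆ Λ.vLePaths v n := by
  rintro μ ⟨hd, hr⟩
  refine ⟨⟨hd.le, fun ν hν hle => ?_⟩, hr⟩
  have h0 : Λ.d ν = 0 := by
    rw [hd] at hle
    exact le_antisymm (by simpa using hle) (zero_le)
  rw [hν]
  exact eq_r_of_d_eq_zero h0

theorem RowFinite.finite_vLePaths (h : Λ.RowFinite) (v : Λ.Path) (n : Fin k → ℕ) :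
    (Λ.vLePaths v n).Finite :=
  ((Set.finite_Iic n).biUnion fun m _ => h v m).subset fun μ hμ =>
    Set.mem_biUnion (x := Λ.d μ) hμ.1.1 ⟨rfl, hμ.2⟩

/-- A path of degree at least `m` has an initial segment of degree `m`. -/
theorem exists_comp_of_le_d (lam : Λ.Path) {m : Fin k → ℕ} (hm : m ≤ Λ.d lam) :
    ∃ (μ ν : Λ.Path) (h : Λ.s μ = Λ.r ν), Λ.d μ = m ∧ Λ.comp μ ν h = lam := by
  obtain ⟨⟨μ, ν⟩, ⟨h, hμ, -, hc⟩, -⟩ :=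
    Λ.factor lam m (Λ.d lam - m) (add_tsub_cancel_of_le hm).symm
  exact ⟨μ, ν, h, hμ, hc⟩

end KGraph

namespace CKFamily

variable {k : ℕ} {Λ : KGraph k} {A : Type*} [NormedRing A] [StarRing A] (ck : CKFamily Λ A)

theorem vertex_r_mul (lam : Λ.Path) : ck.S (Λ.r lam) * ck.S lam = ck.S lam := by
  have h : Λ.s (Λ.r lam) = Λ.r lam := Λ.vertex_s _ (Λ.d_r lam)
  rw [ck.comp_mul _ _ h, Λ.id_comp]

/-- The range projection of `s_λ` lies below `p_{r(λ)}`. -/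
theorem mul_star_self_le [PartialOrder A] [StarOrderedRing A] (lam : Λ.Path) :
    ck.S lam * star (ck.S lam) ≤ ck.S (Λ.r lam) := by
  have hp : star (ck.S (Λ.r lam)) = ck.S (Λ.r lam) := ck.vertex_star _ (Λ.d_r lam)
  have hpp : ck.S (Λ.r lam) * ck.S (Λ.r lam) = ck.S (Λ.r lam) := ck.vertex_idem _ (Λ.d_r lam)
  have hps := ck.vertex_r_mul lam
  have hsp : star (ck.S lam) * ck.S (Λ.r lam) = star (ck.S lam) := by
    simpa [hp] using congrArg star hps
  have hq : ck.S lam * star (ck.S lam) * (ck.S lam * star (ck.S lam)) =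
      ck.S lam * star (ck.S lam) := by
    rw [← mul_assoc, ck.partial_isom]
  rw [← sub_nonneg]
  convert star_mul_self_nonneg (ck.S (Λ.r lam) - ck.S lam * star (ck.S lam)) using 1
  rw [star_sub, star_mul, star_star, hp, mul_sub, sub_mul, sub_mul, hq, hpp, ← mul_assoc, hps,
    mul_assoc, hsp]
  abel

end CKFamily

namespace CstarTrace

variable {A : Type*} [NormedRing A] [StarRing A] [PartialOrder A] [Module ℝ A]
  (τ : CstarTrace A) {k : ℕ} {Λ : KGraph k} (ck : CKFamily Λ A)

theorem range_eq_source (lam : Λ.Path) :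
    τ.τ (ck.S lam * star (ck.S lam)) = τ.τ (ck.S (Λ.s lam)) := by
  rw [← τ.tracial, ck.star_mul_self]

variable [StarOrderedRing A]

theorem mono {a b : A} (ha : 0 ≤ a) (hab : a ≤ b) : τ.τ a ≤ τ.τ b := by
  have h := τ.map_add a (b - a) ha (sub_nonneg.2 hab)
  rw [add_sub_cancel] at h
  exact h ▸ le_self_add

/-- A trace decreases from the range to the source of a path. -/
theorem source_le_range (lam : Λ.Path) : τ.τ (ck.S (Λ.s lam)) ≤ τ.τ (ck.S (Λ.r lam)) := by
  rw [← τ.range_eq_source ck]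
  exact τ.mono (mul_star_self_nonneg _) (ck.mul_star_self_le lam)

/-- Distinct paths of the same degree into `v` have sources of total trace at most `τ(p_v)`. -/
theorem source_add_source_le (hrf : Λ.RowFinite) {e f : Λ.Path} (hd : Λ.d e = Λ.d f)
    (hr : Λ.r e = Λ.r f) (hne : e ≠ f) :
    τ.τ (ck.S (Λ.s e)) + τ.τ (ck.S (Λ.s f)) ≤ τ.τ (ck.S (Λ.r f)) := by
  classical
  have hF := hrf.finite_vLePaths (Λ.r f) (Λ.d f)
  have hsub : ({e, f} : Finset Λ.Path) ⊆ hF.toFinset := by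
    intro μ hμ
    rw [Set.Finite.mem_toFinset]
    apply KGraph.paths_subset_vLePaths
    rcases Finset.mem_insert.1 hμ with rfl | h
    · exact ⟨hd, hr⟩
    · exact Finset.mem_singleton.1 h ▸ ⟨rfl, rfl⟩
  rw [← τ.range_eq_source ck, ← τ.range_eq_source ck,
    ← τ.map_add _ _ (mul_star_self_nonneg _) (mul_star_self_nonneg _)]
  apply τ.mono (add_nonneg (mul_star_self_nonneg _) (mul_star_self_nonneg _))
  rw [ck.cuntz_krieger _ (Λ.d_r f) (Λ.d f) hF.toFinset hF.coe_toFinset,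
    ← Finset.sum_pair (f := fun μ => ck.S μ * star (ck.S μ)) hne]
  exact Finset.sum_le_sum_of_subset_of_nonneg hsub fun μ _ _ => mul_star_self_nonneg _

end CstarTrace

variable {A : Type*} [NormedRing A] [StarRing A] [CStarRing A] [NormedAlgebra ℂ A]
  [StarModule ℂ A] [CompleteSpace A] [PartialOrder A] [StarOrderedRing A]

/-- If `lam` is a loop with an entrance `e`, then any trace which is finite on
`p_{r(lam)}` vanishes on `s_e* s_e` and `s_e s_e*`; a faithful such trace forces
`s_e = 0`. -/
theorem trace_vanishes_on_entrance
    {k : ℕ} (Λ : KGraph k) (hrf : Λ.RowFinite) (hlc : Λ.LocallyConvex)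
    (ck : CKFamily Λ A) (i : Fin k) (lam e : Λ.Path)
    (hloop : Λ.r lam = Λ.s lam) (hge : Pi.single i 1 ≤ Λ.d lam)
    (hde : Λ.d e = Pi.single i 1) (hre : Λ.r e = Λ.r lam)
    (hentrance : ∀ (μ ν : Λ.Path) (h : Λ.s μ = Λ.r ν),
      Λ.d μ = Pi.single i 1 → Λ.comp μ ν h = lam → e ≠ μ)
    (τ : CstarTrace A) (hfin : τ.τ (ck.S (Λ.r lam)) < ⊤) :
    (τ.τ (star (ck.S e) * ck.S e) = 0 ∧ τ.τ (ck.S e * star (ck.S e)) = 0) ∧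
    ((∀ a : A, τ.τ (star a * a) = 0 → a = 0) → ck.S e = 0) := by
  obtain ⟨f, g, h, hf, hc⟩ := KGraph.exists_comp_of_le_d lam hge
  have hrf' : Λ.r f = Λ.r lam := by rw [← hc, Λ.r_comp]
  have hsg : Λ.s g = Λ.r lam := by rw [hloop, ← hc, Λ.s_comp]
  have hsum := τ.source_add_source_le ck hrf (hde.trans hf.symm) (hre.trans hrf'.symm)
    (hentrance f g h hf hc)
  have hle := τ.source_le_range ck g
  rw [hsg, ← h] at hle
  rw [hrf'] at hsum
  have hzero : τ.τ (ck.S (Λ.s e)) = 0 := by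
    have hadd : τ.τ (ck.S (Λ.s e)) + τ.τ (ck.S (Λ.r lam)) ≤ 0 + τ.τ (ck.S (Λ.r lam)) := by
      rw [zero_add]
      exact (add_le_add_right hle _).trans hsum
    exact le_zero_iff.1 ((ENNReal.add_le_add_iff_right hfin.ne).1 hadd)
  have hsource : τ.τ (star (ck.S e) * ck.S e) = 0 := by rw [ck.star_mul_self, hzero]
  exact ⟨⟨hsource, τ.tracial (ck.S e) ▸ hsource⟩, fun hfaithful => hfaithful _ hsource⟩
end

section
/- Let Λ be a row-finite locally convex k-graph, {s_λ : λ ∈ Λ} a Cuntz–Krieger Λ-family in a C*-algebra A, and τ a trace on A. Then for every vertex v ∈ Λ⁰ and every n ∈ ℕ^k one has τ(p_v) = Σ_{λ ∈ vΛ^{≤n}} τ(p_{s(λ)}) in [0,∞]. In particular, if τ(p_v) < ∞ for every vertex v, then the function g_τ : Λ⁰ → [0,∞) defined by g_τ(v) := τ(p_v) is a k-graph trace on Λ. -/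
open scoped BigOperators ENNReal NNReal

namespace CstarTrace

variable {A : Type*} [NormedRing A] [StarRing A] [PartialOrder A] [Module ℝ A]

theorem map_zero (τ : CstarTrace A) : τ.τ 0 = 0 := by
  simpa using τ.map_smul 0 0 le_rfl le_rfl

theorem map_sum [StarOrderedRing A] (τ : CstarTrace A) {ι : Type*} (F : Finset ι) (f : ι → A)
    (hf : ∀ i ∈ F, 0 ≤ f i) : τ.τ (∑ i ∈ F, f i) = ∑ i ∈ F, τ.τ (f i) := by
  classical
  induction F using Finset.induction_on with
  | empty => simpa using τ.map_zero
  | insert a F ha ih =>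
    have hF : ∀ i ∈ F, 0 ≤ f i := fun i hi => hf i (Finset.mem_insert_of_mem hi)
    rw [Finset.sum_insert ha, Finset.sum_insert ha,
      τ.map_add _ _ (hf a (Finset.mem_insert_self a F)) (Finset.sum_nonneg hF), ih hF]

/-- A trace turns the Cuntz–Krieger relation into the graph trace relation. -/
theorem map_vertex_eq_sum [StarOrderedRing A] (τ : CstarTrace A) {k : ℕ} {Λ : KGraph k}
    (ck : CKFamily Λ A) {v : Λ.Path} (hv : Λ.IsVertex v) (n : Fin k → ℕ) (F : Finset Λ.Path)
    (hF : ↑F = Λ.vLePaths v n) : τ.τ (ck.S v) = ∑ lam ∈ F, τ.τ (ck.S (Λ.s lam)) := by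
  rw [ck.cuntz_krieger v hv n F hF, τ.map_sum F _ fun lam _ => mul_star_self_nonneg (ck.S lam)]
  refine Finset.sum_congr rfl fun lam _ => ?_
  rw [← τ.tracial, ck.star_mul_self]

end CstarTrace

variable {A : Type*} [NormedRing A] [StarRing A] [CStarRing A] [NormedAlgebra ℂ A]
  [StarModule ℂ A] [CompleteSpace A] [PartialOrder A] [StarOrderedRing A]

/-- For a trace `τ` on `A`, `τ(p_v) = Σ_{λ ∈ vΛ^{≤n}} τ(p_{s(λ)})`; consequently,
if `τ(p_v) < ∞` for all vertices then `v ↦ τ(p_v)` is a `k`-graph trace on `Λ`. -/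
theorem trace_gives_graph_trace
    {k : ℕ} (Λ : KGraph k) (hrf : Λ.RowFinite) (hlc : Λ.LocallyConvex)
    (ck : CKFamily Λ A) (τ : CstarTrace A) :
    (∀ v : Λ.Path, Λ.IsVertex v → ∀ (n : Fin k → ℕ) (F : Finset Λ.Path),
      ↑F = Λ.vLePaths v n → τ.τ (ck.S v) = ∑ lam ∈ F, τ.τ (ck.S (Λ.s lam))) ∧
    ((∀ v : Λ.Path, Λ.IsVertex v → τ.τ (ck.S v) < ⊤) →
      Λ.IsGraphTrace (fun v => (τ.τ (ck.S v)).toReal)) := by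
  refine ⟨fun v hv n F hF => τ.map_vertex_eq_sum ck hv n F hF,
    fun hfin => ⟨fun v _ => ENNReal.toReal_nonneg, fun v hv n F hF => ?_⟩⟩
  simp only [τ.map_vertex_eq_sum ck hv n F hF]
  exact ENNReal.toReal_sum fun lam _ => (hfin (Λ.s lam) (Λ.d_s lam)).ne
end

section
/- There exists a locally convex, locally finite 2-graph Λ with no sinks and no sources, containing no loops (no non-identity morphism λ with r(λ) = s(λ)), such that Λ admits no faithful k-graph trace: indeed there is a vertex w ∈ Λ⁰ such that every k-graph trace g on Λ satisfies g(w) = 0. -/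
open scoped BigOperators ENNReal NNReal

/-- The 2-graph whose vertices are the integers, with one edge of degree `(1, 0)` and two edges of
degree `(0, 1)` from `n + 1` to `n`, in which the two kinds of edges commute. The triple `(n, a, w)`
is the path with range `n` made of `a` edges of degree `(1, 0)` and the word `w` of edges of
degree `(0, 1)`. -/
def levelGraph : KGraph 2 where
  Path := ℤ × ℕ × List Bool
  countable := inferInstance
  d p := ![p.2.1, p.2.2.length]
  r p := (p.1, 0, [])
  s p := (p.1 + p.2.1 + p.2.2.length, 0, [])
  comp p q _ := (p.1, p.2.1 + q.2.1, p.2.2 ++ q.2.2)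
  d_r _ := by ext i; fin_cases i <;> rfl
  d_s _ := by ext i; fin_cases i <;> rfl
  vertex_r := by
    rintro ⟨n, a, w⟩ h
    have h0 := congrFun h 0
    have h1 := congrFun h 1
    simp_all
  vertex_s := by
    rintro ⟨n, a, w⟩ h
    have h0 := congrFun h 0
    have h1 := congrFun h 1
    simp_all
  r_comp _ _ _ := rfl
  s_comp := by
    rintro ⟨n, a, w⟩ ⟨m, b, u⟩ h
    simp only [Prod.mk.injEq, and_true] at h ⊢
    push_cast [List.length_append]
    omega
  d_comp _ _ _ := by ext i; fin_cases i <;> simp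
  comp_assoc _ _ _ _ _ _ _ := by simp [add_assoc]
  id_comp _ _ := by simp
  comp_id _ _ := by simp
  factor := by
    rintro ⟨n, a, w⟩ m k h
    have h0 : a = m 0 + k 0 := congrFun h 0
    have h1 : w.length = m 1 + k 1 := congrFun h 1
    refine ⟨((n, m 0, w.take (m 1)), (n + m 0 + m 1, k 0, w.drop (m 1))), ⟨?_, ?_, ?_, ?_⟩, ?_⟩
    · simp [h1]
    · ext i; fin_cases i <;> simp [h1]
    · ext i; fin_cases i <;> simp [h1]
    · simp [h0]
    · rintro ⟨⟨n₁, a₁, w₁⟩, ⟨n₂, a₂, w₂⟩⟩ ⟨hs, hm, hk, hc⟩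
      subst hm hk
      simp only [Prod.mk.injEq, and_true] at hs hc
      obtain ⟨rfl, rfl, rfl⟩ := hc
      simp [hs]

namespace levelGraph

theorem d_eq_iff (p : levelGraph.Path) (n : Fin 2 → ℕ) :
    levelGraph.d p = n ↔ p.2.1 = n 0 ∧ p.2.2.length = n 1 := by
  simp [funext_iff, levelGraph]

theorem isVertex_iff (p : levelGraph.Path) :
    levelGraph.IsVertex p ↔ p.2.1 = 0 ∧ p.2.2 = [] := by
  simp [KGraph.IsVertex, d_eq_iff]

theorem finite_of_degree (S : Set levelGraph.Path) (m : ℤ) (a l : ℕ)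
    (hS : ∀ p ∈ S, p.1 = m ∧ p.2.1 = a ∧ p.2.2.length = l) : S.Finite := by
  refine ((Set.finite_singleton m).prod ((Set.finite_singleton a).prod
    (List.finite_length_eq Bool l))).subset ?_
  intro p hp
  exact hS p hp

theorem locallyFinite : levelGraph.LocallyFinite := by
  refine ⟨fun v n => finite_of_degree _ v.1 (n 0) (n 1) ?_,
    fun v n => finite_of_degree _ (v.1 - n 0 - n 1) (n 0) (n 1) ?_⟩
  · rintro p ⟨hd, rfl⟩
    exact ⟨rfl, (d_eq_iff p n).1 hd⟩
  · rintro p ⟨hd, rfl⟩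
    obtain ⟨h0, h1⟩ := (d_eq_iff p n).1 hd
    refine ⟨?_, h0, h1⟩
    simp only [levelGraph, h0, h1]
    omega

theorem noSources : levelGraph.NoSources := by
  rintro ⟨m, a, w⟩ hv n
  obtain ⟨rfl, rfl⟩ := (isVertex_iff _).1 hv
  exact ⟨(m, n 0, List.replicate (n 1) true), (d_eq_iff _ n).2 (by simp), rfl⟩

theorem noSinks : levelGraph.NoSinks := by
  rintro ⟨m, a, w⟩ hv n
  obtain ⟨rfl, rfl⟩ := (isVertex_iff _).1 hv
  refine ⟨(m - n 0 - n 1, n 0, List.replicate (n 1) true), (d_eq_iff _ n).2 (by simp), ?_⟩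
  simp only [levelGraph, List.length_replicate, Prod.mk.injEq, and_true]
  omega

theorem isVertex_of_r_eq_s (p : levelGraph.Path) (h : levelGraph.r p = levelGraph.s p) :
    levelGraph.IsVertex p := by
  have h1 : p.1 = p.1 + p.2.1 + p.2.2.length := congrArg Prod.fst h
  rw [isVertex_iff, ← List.length_eq_zero_iff]
  omega

end levelGraph

namespace KGraph

variable {k : ℕ} {Λ : KGraph k}

theorem NoSources.locallyConvex (h : Λ.NoSources) : Λ.LocallyConvex :=
  fun _ j _ e _ he => absurd he (h (Λ.s e) (Λ.d_s e) (Pi.single j 1)).ne_empty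

theorem NoSources.vLePaths_eq (h : Λ.NoSources) (v : Λ.Path) (n : Fin k → ℕ) :
    Λ.vLePaths v n = Λ.paths v n := by
  ext p
  refine and_congr_left fun _ => ⟨fun ⟨hle, hmax⟩ => ?_, fun hd => ⟨hd.le, fun μ hμ hle => ?_⟩⟩
  · obtain ⟨μ, hd, hr⟩ := h (Λ.s p) (Λ.d_s p) (n - Λ.d p)
    have hn : Λ.d p + Λ.d μ = n := by rw [hd, add_tsub_cancel_of_le hle]
    have hμ : Λ.d μ = 0 := by rw [hmax μ hr.symm hn.le, Λ.d_s]
    rwa [hμ, add_zero] at hn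
  · have hμ0 : Λ.d μ = 0 := by
      rw [hd] at hle
      exact le_antisymm (by simpa using hle) zero_le
    rw [hμ, Λ.vertex_r μ hμ0]

end KGraph

namespace levelGraph

theorem trace_eq_sum (g : ℤ × ℕ × List Bool → ℝ) (hg : levelGraph.IsGraphTrace g) (m : ℤ)
    (n : Fin 2 → ℕ) (F : Finset (ℤ × ℕ × List Bool))
    (hF : ∀ p, p ∈ F ↔ (p.2.1 = n 0 ∧ p.2.2.length = n 1) ∧ p.1 = m) :
    g (m, 0, []) = ∑ p ∈ F, g (p.1 + p.2.1 + p.2.2.length, 0, []) := by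
  refine hg.2 (m, 0, []) ((isVertex_iff _).2 ⟨rfl, rfl⟩) n F ?_
  refine Eq.trans (Set.ext fun p => ?_) (noSources.vLePaths_eq _ _).symm
  refine (hF p).trans (and_congr (d_eq_iff p n).symm ⟨?_, congrArg Prod.fst⟩)
  rintro rfl
  rfl

theorem trace_eq_zero (g : ℤ × ℕ × List Bool → ℝ) (hg : levelGraph.IsGraphTrace g) (m : ℤ) :
    g (m, 0, []) = 0 := by
  have hone : g (m, 0, []) = g (m + 1, 0, []) := by
    have := trace_eq_sum g hg m ![1, 0] {(m, 1, [])} (by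
      rintro ⟨n, a, w⟩
      simp
      tauto)
    simpa using this
  have htwo : g (m, 0, []) = g (m + 1, 0, []) + g (m + 1, 0, []) := by
    have := trace_eq_sum g hg m ![0, 1] {(m, 0, [false]), (m, 0, [true])} (by
      rintro ⟨n, a, w⟩
      simp [List.length_eq_one_iff]
      tauto)
    rw [Finset.sum_pair (by simp)] at this
    simpa using this
  linarith

end levelGraph

/-- There is a locally convex, locally finite 2-graph with no sinks, no sources and
no loops, which nevertheless admits no faithful graph trace: some vertex is killed
by every graph trace. -/
theorem exists_two_graph_without_faithful_trace :
    ∃ Λ : KGraph 2, Λ.LocallyConvex ∧ Λ.LocallyFinite ∧ Λ.NoSinks ∧ Λ.NoSources ∧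
      (∀ lam : Λ.Path, Λ.r lam = Λ.s lam → Λ.IsVertex lam) ∧
      ∃ w : Λ.Path, Λ.IsVertex w ∧
        ∀ g : Λ.Path → ℝ, Λ.IsGraphTrace g → g w = 0 := by
  exact ⟨levelGraph, levelGraph.noSources.locallyConvex, levelGraph.locallyFinite,
    levelGraph.noSinks, levelGraph.noSources, levelGraph.isVertex_of_r_eq_s, (0, 0, []),
    (levelGraph.isVertex_iff _).2 ⟨rfl, rfl⟩, fun g hg => levelGraph.trace_eq_zero g hg 0⟩
end

section
/- Let Λ be a row-finite locally convex k-graph, g a k-graph trace on Λ, and x an end of Λ. Then g is constant on the vertices of x: g(x(n)) = g(x(0)) for every n ∈ ℕ^k with n ≤ d(x). -/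
open scoped BigOperators ENNReal NNReal

/-- For an end `x` and `n ≤ d(x)`, the only element of `r(x)Λ^{≤n}` is `x(0,n)`. -/
theorem KGraph.IsEnd.vLePaths_eq_singleton {k : ℕ} {Λ : KGraph k} {x : Λ.BoundaryPath}
    (hx : Λ.IsEnd x) {n : Fin k → ℕ} (hn : ∀ i, (n i : ℕ∞) ≤ x.deg i) :
    Λ.vLePaths (x.seg 0 0) n = {x.seg 0 n} := by
  have h0n : (0 : Fin k → ℕ) ≤ n := fun i => Nat.zero_le _
  ext lam
  simp only [Set.mem_singleton_iff]
  constructor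
  · rintro ⟨⟨hle, hmax⟩, hr⟩
    have hm : ∀ i, (Λ.d lam i : ℕ∞) ≤ x.deg i := fun i =>
      (Nat.cast_le.mpr (hle i)).trans (hn i)
    have hlam : lam = x.seg 0 (Λ.d lam) := by
      have hmem : lam ∈ Λ.paths (x.seg 0 0) (Λ.d lam) := ⟨rfl, hr⟩
      rwa [hx _ hm] at hmem
    have hs : Λ.s lam = x.seg (Λ.d lam) (Λ.d lam) := by
      rw [← x.seg_s 0 _ (fun i => Nat.zero_le _) hm, ← hlam]
    have hd := x.seg_d _ n hle hn
    have htail := hmax (x.seg (Λ.d lam) n) (hs.trans (x.seg_r _ n hle hn).symm)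
      (by rw [hd, add_tsub_cancel_of_le hle])
    rw [htail, Λ.d_s] at hd
    have hdeg : Λ.d lam = n := le_antisymm hle (tsub_eq_zero_iff_le.mp hd.symm)
    rwa [hdeg] at hlam
  · rintro rfl
    have hd : Λ.d (x.seg 0 n) = n := by rw [x.seg_d 0 n h0n hn, tsub_zero]
    refine ⟨⟨hd.le, fun μ hμ hle => ?_⟩, x.seg_r 0 n h0n hn⟩
    rw [hd] at hle
    have hμ0 : Λ.d μ = 0 := by
      funext i
      have := hle i
      simp only [Pi.add_apply] at this
      simp only [Pi.zero_apply]
      omega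
    rw [hμ, Λ.vertex_r μ hμ0]


/-- A graph trace is constant on the vertices of an end. -/
theorem graph_trace_constant_on_ends
    {k : ℕ} (Λ : KGraph k) (hrf : Λ.RowFinite) (hlc : Λ.LocallyConvex)
    (g : Λ.Path → ℝ) (hg : Λ.IsGraphTrace g)
    (x : Λ.BoundaryPath) (hx : Λ.IsEnd x)
    (n : Fin k → ℕ) (hn : ∀ i, (n i : ℕ∞) ≤ x.deg i) :
    g (x.seg n n) = g (x.seg 0 0) := by
  have hvertex : Λ.IsVertex (x.seg 0 0) := by
    simpa [KGraph.IsVertex] using x.seg_d 0 0 le_rfl (by simp)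
  have h := hg.2 (x.seg 0 0) hvertex n {x.seg 0 n}
    (by rw [Finset.coe_singleton, hx.vLePaths_eq_singleton hn])
  rw [Finset.sum_singleton, x.seg_s 0 n (fun i => Nat.zero_le _) hn] at h
  exact h.symm
end

section
/- Let Λ be a row-finite locally convex k-graph and suppose there is a function v ↦ n_v from Λ⁰ to ℕ^k such that for every v ∈ Λ⁰ and every λ ∈ vΛ^{≤n_v}, the vertex s(λ) lies on an end of Λ. If g is a k-graph trace on Λ, then g(x(0)) = g(y(0)) whenever x and y are equivalent ends (x ∼ y), so there is a well-defined function on ∼-classes of ends given by g([x]) := g(x(0)), and moreover g(v) = Σ_{λ ∈ vΛ^{≤n_v}} g([x_{s(λ)}]) for every vertex v ∈ Λ⁰, where x_{s(λ)} denotes any end on which s(λ) lies. -/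
open scoped BigOperators ENNReal NNReal

namespace KGraph

variable {k : ℕ} {Λ : KGraph k}

theorem BoundaryPath.isVertex_seg (x : Λ.BoundaryPath) {n : Fin k → ℕ}
    (hn : ∀ i, (n i : ℕ∞) ≤ x.deg i) : Λ.IsVertex (x.seg n n) := by
  simpa [IsVertex] using x.seg_d n n le_rfl hn

/-- Paths of degree exactly `n` belong to `Λ^{≤ n}`. -/
theorem mem_lePaths_of_d_eq {lam : Λ.Path} {n : Fin k → ℕ} (h : Λ.d lam = n) :
    lam ∈ Λ.lePaths n := by
  refine ⟨h.le, fun μ hμ hle => ?_⟩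
  have h0 : Λ.d μ = 0 := by
    funext i
    have hi : Λ.d lam i + Λ.d μ i ≤ n i := hle i
    rw [h] at hi
    simp only [Pi.zero_apply]
    omega
  rw [hμ, Λ.vertex_r μ h0]

/-- For an end `x` and `n ≤ d(x)`, the only element of `x(0)Λ^{≤ n}` is `x(0,n)`. -/
theorem IsEnd.vLePaths_eq {x : Λ.BoundaryPath} (hx : Λ.IsEnd x) {n : Fin k → ℕ}
    (hn : ∀ i, (n i : ℕ∞) ≤ x.deg i) : Λ.vLePaths (x.seg 0 0) n = {x.seg 0 n} := by
  ext lam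
  rw [Set.mem_singleton_iff]
  constructor
  · rintro ⟨⟨hle, hmax⟩, hr⟩
    have hm : ∀ i, (Λ.d lam i : ℕ∞) ≤ x.deg i := fun i =>
      le_trans (by exact_mod_cast hle i) (hn i)
    have hlam : lam = x.seg 0 (Λ.d lam) := by
      have : lam ∈ Λ.paths (x.seg 0 0) (Λ.d lam) := ⟨rfl, hr⟩
      rwa [hx _ hm] at this
    have hs : Λ.s lam = x.seg (Λ.d lam) (Λ.d lam) := by
      conv_lhs => rw [hlam]
      exact x.seg_s 0 _ zero_le hm
    have hd := x.seg_d (Λ.d lam) n hle hn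
    have hseg := hmax (x.seg (Λ.d lam) n) (by rw [hs, x.seg_r _ _ hle hn])
      (by rw [hd, add_tsub_cancel_of_le hle])
    rw [hseg, Λ.d_s] at hd
    have hdn : Λ.d lam = n := le_antisymm hle (tsub_eq_zero_iff_le.mp hd.symm)
    rwa [hdn] at hlam
  · rintro rfl
    exact ⟨mem_lePaths_of_d_eq (by simpa using x.seg_d 0 n zero_le hn),
      x.seg_r 0 n zero_le hn⟩

/-- A graph trace is constant along an end. -/
theorem IsGraphTrace.seg_zero_eq {g : Λ.Path → ℝ} (hg : Λ.IsGraphTrace g)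
    {x : Λ.BoundaryPath} (hx : Λ.IsEnd x) {n : Fin k → ℕ}
    (hn : ∀ i, (n i : ℕ∞) ≤ x.deg i) : g (x.seg 0 0) = g (x.seg n n) := by
  have h := hg.2 (x.seg 0 0) (x.isVertex_seg (by simp)) n {x.seg 0 n}
    (by rw [hx.vLePaths_eq hn, Finset.coe_singleton])
  rwa [Finset.sum_singleton, x.seg_s 0 n zero_le hn] at h

end KGraph

/-- If every vertex reaches ends within `N v` steps, then every graph trace is
constant on equivalence classes of ends, and `g(v) = Σ_{λ ∈ vΛ^{≤N v}} g([x_{s(λ)}])`. -/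
theorem graph_trace_determined_by_ends
    {k : ℕ} (Λ : KGraph k) (hrf : Λ.RowFinite) (hlc : Λ.LocallyConvex)
    (N : Λ.Path → Fin k → ℕ)
    (hN : ∀ v : Λ.Path, Λ.IsVertex v → ∀ lam ∈ Λ.vLePaths v (N v),
      ∃ x : Λ.BoundaryPath, Λ.IsEnd x ∧ Λ.LiesOn (Λ.s lam) x)
    (g : Λ.Path → ℝ) (hg : Λ.IsGraphTrace g) :
    (∀ x y : Λ.BoundaryPath, Λ.IsEnd x → Λ.IsEnd y → Λ.EndEquiv x y →
      g (x.seg 0 0) = g (y.seg 0 0)) ∧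
    (∀ v : Λ.Path, Λ.IsVertex v → ∀ F : Finset Λ.Path, ↑F = Λ.vLePaths v (N v) →
      ∀ E : Λ.Path → Λ.BoundaryPath,
        (∀ lam ∈ F, Λ.IsEnd (E lam) ∧ Λ.LiesOn (Λ.s lam) (E lam)) →
        g v = ∑ lam ∈ F, g ((E lam).seg 0 0)) := by
  refine ⟨?_, ?_⟩
  · rintro x y hx hy ⟨n, m, hn, hm, hnm⟩
    rw [hg.seg_zero_eq hx hn, hg.seg_zero_eq hy hm, hnm]
  · intro v hv F hF E hE
    rw [hg.2 v hv (N v) F hF]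
    refine Finset.sum_congr rfl fun lam hlam => ?_
    obtain ⟨hend, n, hn, hs⟩ := hE lam hlam
    rw [hs, hg.seg_zero_eq hend hn]
end

section
/- Let Λ be a row-finite locally convex k-graph and suppose there is a function v ↦ n_v from Λ⁰ to ℕ^k such that for every v ∈ Λ⁰ and every λ ∈ vΛ^{≤n_v}, the vertex s(λ) lies on an end of Λ. Then for every function g from the set of ∼-classes of ends of Λ to [0,∞), there is a unique k-graph trace ḡ on Λ satisfying ḡ(x(0)) = g([x]) for every end x of Λ. -/
open scoped BigOperators ENNReal NNReal

namespace KGraph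

variable {k : ℕ} {Λ : KGraph k}

lemma r_s_eq (lam : Λ.Path) : Λ.r (Λ.s lam) = Λ.s lam := Λ.vertex_r _ (Λ.d_s lam)

lemma exists_factor (lam : Λ.Path) (m n : Fin k → ℕ) (h : Λ.d lam = m + n) :
    ∃ (μ ν : Λ.Path) (e : Λ.s μ = Λ.r ν), Λ.d μ = m ∧ Λ.d ν = n ∧ Λ.comp μ ν e = lam := by
  obtain ⟨⟨μ, ν⟩, ⟨e, hμ, hν, hc⟩, -⟩ := Λ.factor lam m n h
  exact ⟨μ, ν, e, hμ, hν, hc⟩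

lemma factor_unique {μ ν μ' ν' : Λ.Path} (e : Λ.s μ = Λ.r ν) (e' : Λ.s μ' = Λ.r ν')
    (hc : Λ.comp μ ν e = Λ.comp μ' ν' e') (hd : Λ.d μ = Λ.d μ') : μ = μ' ∧ ν = ν' := by
  have hν : Λ.d ν = Λ.d ν' := by
    have := congrArg Λ.d hc
    rw [Λ.d_comp, Λ.d_comp, hd] at this
    exact add_left_cancel this
  have := (Λ.factor (Λ.comp μ ν e) (Λ.d μ) (Λ.d ν) (Λ.d_comp _ _ _)).unique
    (y₁ := (μ, ν)) (y₂ := (μ', ν')) ⟨e, rfl, rfl, rfl⟩ ⟨e', hd.symm, hν.symm, hc.symm⟩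
  exact Prod.mk.inj this

lemma single_le_iff {i : Fin k} {a : ℕ} {n : Fin k → ℕ} :
    Pi.single i a ≤ n ↔ a ≤ n i := by
  constructor
  · intro h
    simpa using h i
  · intro h j
    rcases eq_or_ne j i with rfl | hj
    · simpa using h
    · simp [hj]

lemma paths_single_nonempty {lam : Λ.Path} {i : Fin k} (h : 0 < Λ.d lam i) :
    (Λ.paths (Λ.r lam) (Pi.single i 1)).Nonempty := by
  obtain ⟨μ, ν, e, hμ, -, hc⟩ := exists_factor lam (Pi.single i 1) (Λ.d lam - Pi.single i 1)
    (add_tsub_cancel_of_le (single_le_iff.2 h)).symm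
  exact ⟨μ, hμ, by rw [← hc, Λ.r_comp]⟩

lemma mem_lePaths_iff {lam : Λ.Path} {n : Fin k → ℕ} :
    lam ∈ Λ.lePaths n ↔ Λ.d lam ≤ n ∧
      ∀ i, Λ.d lam i < n i → Λ.paths (Λ.s lam) (Pi.single i 1) = ∅ := by
  refine and_congr_right fun hle => ⟨fun h i hi => ?_, fun h μ e hμ => ?_⟩
  · by_contra hne
    obtain ⟨f, hf, hr⟩ := Set.nonempty_iff_ne_empty.2 hne
    have hfs : f = Λ.s lam := by
      refine h f hr.symm fun j => ?_
      rw [hf]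
      rcases eq_or_ne j i with rfl | hj
      · simpa using hi
      · simpa [hj] using hle j
    have h0 : Λ.d f i = 0 := by rw [hfs, Λ.d_s]; rfl
    rw [hf] at h0
    simp at h0
  · have h0 : Λ.d μ = 0 := by
      funext i
      by_contra hi
      have hpos : 0 < Λ.d μ i := Nat.pos_of_ne_zero hi
      have hlt : Λ.d lam i < n i := by
        have := hμ i
        simp only [Pi.add_apply] at this
        omega
      have hne := paths_single_nonempty hpos
      rw [← e, h i hlt] at hne
      exact Set.not_nonempty_empty hne
    rw [e, Λ.vertex_r μ h0]

/-- Absence of edges of a given colour passes from the range to the source of a path. -/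
lemma paths_s_eq_empty {lam : Λ.Path} {i : Fin k}
    (h : Λ.paths (Λ.r lam) (Pi.single i 1) = ∅) :
    Λ.paths (Λ.s lam) (Pi.single i 1) = ∅ := by
  by_contra hne
  obtain ⟨f, hf, hr⟩ := Set.nonempty_iff_ne_empty.2 hne
  have := paths_single_nonempty (lam := Λ.comp lam f hr.symm) (i := i)
    (by rw [Λ.d_comp, hf]; simp)
  rw [Λ.r_comp, h] at this
  exact Set.not_nonempty_empty this

/-- In a locally convex `k`-graph, absence of edges of a given colour passes from the source
to the range of a path without edges of that colour. -/
lemma LocallyConvex.paths_r_eq_empty (hlc : Λ.LocallyConvex) {i : Fin k} {lam : Λ.Path}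
    (hi : Λ.d lam i = 0) (h : Λ.paths (Λ.s lam) (Pi.single i 1) = ∅) :
    Λ.paths (Λ.r lam) (Pi.single i 1) = ∅ := by
  induction hN : ∑ j, Λ.d lam j using Nat.strong_induction_on generalizing lam with
  | _ N ih =>
    by_cases h0 : Λ.d lam = 0
    · rw [Λ.vertex_s _ h0] at h
      rwa [Λ.vertex_r _ h0]
    · obtain ⟨j, hj⟩ := Function.ne_iff.1 h0
      have hj' : 0 < Λ.d lam j := Nat.pos_of_ne_zero hj
      have hd := (add_tsub_cancel_of_le (single_le_iff.2 hj' :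
        (Pi.single j 1 : Fin k → ℕ) ≤ Λ.d lam)).symm
      obtain ⟨μ, ν, e, hμ, hν, hc⟩ := exists_factor lam _ _ hd
      have hsum : ∑ l, Λ.d ν l < N := by
        rw [← hN, ← hc, Λ.d_comp, hμ]
        simp [Finset.sum_add_distrib]
      have hνi : Λ.d ν i = 0 := by rw [hν]; simp [hi]
      have hs : Λ.s ν = Λ.s lam := by rw [← hc, Λ.s_comp]
      have hr : Λ.r μ = Λ.r lam := by rw [← hc, Λ.r_comp]
      have hνr := ih _ hsum hνi (by rwa [hs]) rfl
      rw [← hr]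
      exact hlc j i (by rintro rfl; exact hj hi) μ hμ (by rwa [e])

lemma vLePaths_finite (hrf : Λ.RowFinite) (v : Λ.Path) (n : Fin k → ℕ) :
    (Λ.vLePaths v n).Finite := by
  refine ((Set.finite_Icc (0 : Fin k → ℕ) n).biUnion fun m _ => hrf v m).subset ?_
  rintro lam ⟨hle, hr⟩
  exact Set.mem_biUnion (x := Λ.d lam) ⟨zero_le, hle.1⟩ ⟨rfl, hr⟩

/-- The set `vΛ^{≤ n}` as a finset. -/
noncomputable def leFinset (hrf : Λ.RowFinite) (v : Λ.Path) (n : Fin k → ℕ) : Finset Λ.Path :=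
  (vLePaths_finite hrf v n).toFinset

lemma mem_leFinset {hrf : Λ.RowFinite} {v lam : Λ.Path} {n : Fin k → ℕ} :
    lam ∈ leFinset hrf v n ↔ lam ∈ Λ.lePaths n ∧ Λ.r lam = v := by
  simp [leFinset, vLePaths]

lemma coe_leFinset (hrf : Λ.RowFinite) (v : Λ.Path) (n : Fin k → ℕ) :
    (leFinset hrf v n : Set Λ.Path) = Λ.vLePaths v n := by
  simp [leFinset]

lemma isGraphTrace_iff (hrf : Λ.RowFinite) {g : Λ.Path → ℝ} :
    Λ.IsGraphTrace g ↔ (∀ v, Λ.IsVertex v → 0 ≤ g v) ∧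
      ∀ v, Λ.IsVertex v → ∀ n, g v = ∑ lam ∈ leFinset hrf v n, g (Λ.s lam) := by
  refine and_congr_right fun _ => forall₃_congr fun v _ n => ⟨fun h => ?_, fun h F hF => ?_⟩
  · exact h _ (coe_leFinset hrf v n)
  · rw [h, Finset.coe_injective (hF.trans (coe_leFinset hrf v n).symm)]

lemma comp_mem_lePaths {μ ν : Λ.Path} {m n : Fin k → ℕ} (e : Λ.s μ = Λ.r ν)
    (hμ : μ ∈ Λ.lePaths m) (hν : ν ∈ Λ.lePaths n) : Λ.comp μ ν e ∈ Λ.lePaths (m + n) := by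
  rw [mem_lePaths_iff] at *
  rw [Λ.d_comp, Λ.s_comp]
  refine ⟨add_le_add hμ.1 hν.1, fun i hi => ?_⟩
  simp only [Pi.add_apply] at hi
  by_cases hi' : Λ.d ν i < n i
  · exact hν.2 i hi'
  · exact paths_s_eq_empty (e ▸ hμ.2 i (by omega))

lemma d_eq_inf_of_mem_lePaths {μ ν : Λ.Path} {m : Fin k → ℕ} (e : Λ.s μ = Λ.r ν)
    (hμ : μ ∈ Λ.lePaths m) : Λ.d μ = Λ.d (Λ.comp μ ν e) ⊓ m := by
  rw [mem_lePaths_iff] at hμ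
  funext i
  rw [Λ.d_comp]
  have hle : Λ.d μ i ≤ m i := hμ.1 i
  simp only [Pi.inf_apply, Pi.add_apply]
  rcases hle.lt_or_eq with hi | hi
  · have : Λ.d ν i = 0 := by
      by_contra h0
      have hne := paths_single_nonempty (Nat.pos_of_ne_zero h0)
      rw [← e, hμ.2 i hi] at hne
      exact Set.not_nonempty_empty hne
    omega
  · omega

/-- In a locally convex `k`-graph, `Λ^{≤ m + n} ⊆ Λ^{≤ m} Λ^{≤ n}`. -/
lemma LocallyConvex.exists_lePaths_factor (hlc : Λ.LocallyConvex) {lam : Λ.Path}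
    {m n : Fin k → ℕ} (h : lam ∈ Λ.lePaths (m + n)) :
    ∃ (μ ν : Λ.Path) (e : Λ.s μ = Λ.r ν), μ ∈ Λ.lePaths m ∧ ν ∈ Λ.lePaths n ∧
      Λ.comp μ ν e = lam := by
  obtain ⟨hle, hlam⟩ := mem_lePaths_iff.1 h
  obtain ⟨μ, ν, e, hμ, hν, hc⟩ := exists_factor lam (Λ.d lam ⊓ m) (Λ.d lam - Λ.d lam ⊓ m)
    (add_tsub_cancel_of_le inf_le_left).symm
  have hs : Λ.s lam = Λ.s ν := by rw [← hc, Λ.s_comp]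
  have hμi (i) : Λ.d μ i = Λ.d lam i ⊓ m i := by rw [hμ]; rfl
  have hνi (i) : Λ.d ν i = Λ.d lam i - Λ.d lam i ⊓ m i := by rw [hν]; rfl
  have hlei (i) : Λ.d lam i ≤ m i + n i := hle i
  simp only [Pi.add_apply, hs] at hlam
  refine ⟨μ, ν, e, mem_lePaths_iff.2 ⟨hμ ▸ inf_le_right, fun i hi => ?_⟩,
    mem_lePaths_iff.2 ⟨fun i => ?_, fun i hi => ?_⟩, hc⟩
  · have := hμi i
    have := hνi i
    rw [e]
    exact hlc.paths_r_eq_empty (by omega) (hlam i (by omega))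
  · have := hνi i
    have := hlei i
    change Λ.d ν i ≤ n i
    omega
  · have := hνi i
    exact hlam i (by omega)

lemma sum_leFinset_add (hrf : Λ.RowFinite) (hlc : Λ.LocallyConvex) (f : Λ.Path → ℝ)
    (v : Λ.Path) (m n : Fin k → ℕ) :
    ∑ lam ∈ leFinset hrf v (m + n), f (Λ.s lam) =
      ∑ μ ∈ leFinset hrf v m, ∑ ν ∈ leFinset hrf (Λ.s μ) n, f (Λ.s ν) := by
  rw [Finset.sum_sigma']
  symm
  have key : ∀ p ∈ (leFinset hrf v m).sigma fun μ => leFinset hrf (Λ.s μ) n,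
      (p.1 ∈ Λ.lePaths m ∧ Λ.r p.1 = v) ∧ p.2 ∈ Λ.lePaths n ∧ Λ.r p.2 = Λ.s p.1 := by
    intro p hp
    rw [Finset.mem_sigma, mem_leFinset, mem_leFinset] at hp
    exact hp
  refine Finset.sum_bij (fun p hp => Λ.comp p.1 p.2 (key p hp).2.2.symm) ?_ ?_ ?_ ?_
  · intro p hp
    obtain ⟨⟨h1, h2⟩, h3, h4⟩ := key p hp
    exact mem_leFinset.2 ⟨comp_mem_lePaths _ h1 h3, by rw [Λ.r_comp, h2]⟩
  · rintro ⟨μ, ν⟩ hp ⟨μ', ν'⟩ hp' hc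
    obtain ⟨⟨h1, -⟩, -, h4⟩ := key _ hp
    obtain ⟨⟨h1', -⟩, -, h4'⟩ := key _ hp'
    obtain ⟨rfl, rfl⟩ := factor_unique h4.symm h4'.symm hc
      ((d_eq_inf_of_mem_lePaths h4.symm h1).trans
        ((congrArg (fun l => Λ.d l ⊓ m) hc).trans (d_eq_inf_of_mem_lePaths h4'.symm h1').symm))
    rfl
  · intro lam hlam
    rw [mem_leFinset] at hlam
    obtain ⟨μ, ν, e, hμ, hν, hc⟩ := hlc.exists_lePaths_factor hlam.1
    refine ⟨⟨μ, ν⟩, ?_, hc⟩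
    rw [Finset.mem_sigma, mem_leFinset, mem_leFinset]
    exact ⟨⟨hμ, by rw [← hlam.2, ← hc, Λ.r_comp]⟩, hν, e.symm⟩
  · intro p hp
    rw [Λ.s_comp]

lemma leFinset_nonempty (hrf : Λ.RowFinite) {v : Λ.Path} (hv : Λ.IsVertex v) (n : Fin k → ℕ) :
    (leFinset hrf v n).Nonempty := by
  have hfin : {lam : Λ.Path | Λ.d lam ≤ n ∧ Λ.r lam = v}.Finite := by
    refine ((Set.finite_Icc (0 : Fin k → ℕ) n).biUnion fun m _ => hrf v m).subset ?_
    rintro lam ⟨hle, hr⟩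
    exact Set.mem_biUnion (x := Λ.d lam) ⟨zero_le, hle⟩ ⟨rfl, hr⟩
  obtain ⟨lam, ⟨hle, hr⟩, hmax⟩ := Set.exists_max_image _ (fun lam => ∑ i, Λ.d lam i) hfin
    ⟨v, by rw [show Λ.d v = 0 from hv]; exact zero_le, Λ.vertex_r v hv⟩
  refine ⟨lam, mem_leFinset.2 ⟨⟨hle, fun μ e hμ => ?_⟩, hr⟩⟩
  have := hmax (Λ.comp lam μ e) ⟨by rwa [Λ.d_comp], by rw [Λ.r_comp, hr]⟩
  simp only [Λ.d_comp, Pi.add_apply, Finset.sum_add_distrib, add_le_iff_nonpos_right,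
    nonpos_iff_eq_zero, Finset.sum_eq_zero_iff, Finset.mem_univ, true_implies] at this
  rw [e, Λ.vertex_r μ (funext this)]

section Ends

variable {x : Λ.BoundaryPath} {p : Fin k → ℕ} {lam : Λ.Path}

lemma IsEnd.eq_seg_of_le (hx : Λ.IsEnd x) (hr : Λ.r lam = x.seg p p)
    (hle : ∀ i, ((p + Λ.d lam) i : ℕ∞) ≤ x.deg i) : lam = x.seg p (p + Λ.d lam) := by
  have hpq : p ≤ p + Λ.d lam := le_self_add
  have hp : ∀ i, (p i : ℕ∞) ≤ x.deg i := fun i =>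
    le_trans (by exact_mod_cast hpq i) (hle i)
  have e : Λ.s (x.seg 0 p) = Λ.r lam := by rw [x.seg_s 0 p zero_le hp, hr]
  have e' : Λ.s (x.seg 0 p) = Λ.r (x.seg p (p + Λ.d lam)) := by
    rw [e, hr, x.seg_r p _ hpq hle]
  have hmem : Λ.comp (x.seg 0 p) lam e ∈ Λ.paths (x.seg 0 0) (p + Λ.d lam) :=
    ⟨by rw [Λ.d_comp, x.seg_d 0 p zero_le hp, tsub_zero],
      by rw [Λ.r_comp, x.seg_r 0 p zero_le hp]⟩
  rw [hx _ hle, Set.mem_singleton_iff, ← x.seg_comp 0 p _ zero_le hpq hle e'] at hmem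
  exact (factor_unique _ _ hmem rfl).2

lemma IsEnd.add_d_le (hx : Λ.IsEnd x) (hp : ∀ i, (p i : ℕ∞) ≤ x.deg i)
    (hr : Λ.r lam = x.seg p p) (i : Fin k) : ((p + Λ.d lam) i : ℕ∞) ≤ x.deg i := by
  by_contra! hlt
  obtain ⟨D, hD⟩ := ENat.ne_top_iff_exists.1 (ne_top_of_lt hlt)
  have hpi := hp i
  rw [← hD] at hlt hpi
  norm_cast at hlt hpi
  rw [Pi.add_apply] at hlt
  obtain ⟨α, β, e, hα, hβ, hc⟩ := exists_factor lam (Pi.single i (D - p i)) _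
    (add_tsub_cancel_of_le (single_le_iff.2 (by omega))).symm
  have hrα : Λ.r α = x.seg p p := by rw [← hr, ← hc, Λ.r_comp]
  have hq : ∀ j, ((p + Λ.d α) j : ℕ∞) ≤ x.deg j := by
    intro j
    rw [hα]
    rcases eq_or_ne j i with rfl | hj
    · rw [← hD]
      norm_cast
      simp [hpi]
    · simpa [hj] using hp j
  have hsα : Λ.s α = x.seg (p + Λ.d α) (p + Λ.d α) := by
    rw [← x.seg_s p _ le_self_add hq, ← hx.eq_seg_of_le hrα hq]
  have hne := paths_single_nonempty (lam := β) (i := i) (by rw [hβ]; simp; omega)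
  rw [← e, hsα, x.boundary i _ hq (by rw [← hD, hα]; norm_cast; simp [hpi])] at hne
  exact Set.not_nonempty_empty hne

lemma IsEnd.liesOn_s (hx : Λ.IsEnd x) (h : Λ.LiesOn (Λ.r lam) x) : Λ.LiesOn (Λ.s lam) x := by
  obtain ⟨p, hp, hr⟩ := h
  have hle := hx.add_d_le hp hr
  exact ⟨_, hle, by rw [← x.seg_s p _ le_self_add hle, ← hx.eq_seg_of_le hr hle]⟩

lemma LiesOn.isVertex {v : Λ.Path} (h : Λ.LiesOn v x) : Λ.IsVertex v := by
  obtain ⟨p, hp, rfl⟩ := h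
  exact (x.seg_d p p le_rfl hp).trans (tsub_self p)

lemma IsEnd.d_le_of_mem_lePaths (hx : Λ.IsEnd x) {n : Fin k → ℕ} {μ : Λ.Path}
    (h : Λ.LiesOn (Λ.r lam) x) (hr : Λ.r μ = Λ.r lam) (hlam : lam ∈ Λ.lePaths n)
    (hμ : Λ.d μ ≤ n) : Λ.d μ ≤ Λ.d lam := by
  obtain ⟨p, hp, hlp⟩ := h
  intro i
  by_contra! hi
  have hle := hx.add_d_le hp hlp
  have hle' := hx.add_d_le hp (hr.trans hlp)
  have hq : ∀ j, ((p + Λ.d lam + Pi.single i 1 : Fin k → ℕ) j : ℕ∞) ≤ x.deg j := by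
    intro j
    rcases eq_or_ne j i with rfl | hj
    · refine le_trans ?_ (hle' j)
      norm_cast
      simp only [Pi.add_apply, Pi.single_eq_same, add_assoc]
      exact Nat.add_le_add_left hi _
    · simpa [hj] using hle j
  have hempty := (mem_lePaths_iff.1 hlam).2 i (hi.trans_le (hμ i))
  have hmem : x.seg (p + Λ.d lam) (p + Λ.d lam + Pi.single i 1) ∈
      Λ.paths (Λ.s lam) (Pi.single i 1) := by
    refine ⟨by rw [x.seg_d _ _ le_self_add hq, add_tsub_cancel_left], ?_⟩
    rw [x.seg_r _ _ le_self_add hq, ← x.seg_s p _ le_self_add hle,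
      ← hx.eq_seg_of_le hlp hle]
  rw [hempty] at hmem
  exact hmem

lemma IsEnd.eq_of_mem_lePaths (hx : Λ.IsEnd x) {n : Fin k → ℕ} {μ : Λ.Path}
    (h : Λ.LiesOn (Λ.r lam) x) (hr : Λ.r μ = Λ.r lam) (hlam : lam ∈ Λ.lePaths n)
    (hμ : μ ∈ Λ.lePaths n) : μ = lam := by
  have hd : Λ.d μ = Λ.d lam := le_antisymm (hx.d_le_of_mem_lePaths h hr hlam hμ.1)
    (hx.d_le_of_mem_lePaths (hr ▸ h) hr.symm hμ hlam.1)
  obtain ⟨p, hp, hlp⟩ := h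
  rw [hx.eq_seg_of_le hlp (hx.add_d_le hp hlp),
    hx.eq_seg_of_le (hr.trans hlp) (hx.add_d_le hp (hr.trans hlp)), hd]

/-- If `v` lies on an end, then `vΛ^{≤ n}` is a singleton. -/
lemma IsEnd.exists_leFinset_eq_singleton (hrf : Λ.RowFinite) (hx : Λ.IsEnd x) {v : Λ.Path}
    (h : Λ.LiesOn v x) (n : Fin k → ℕ) :
    ∃ lam, leFinset hrf v n = {lam} ∧ Λ.LiesOn (Λ.s lam) x := by
  obtain ⟨lam, hlam⟩ := leFinset_nonempty hrf (LiesOn.isVertex h) n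
  obtain ⟨hl, rfl⟩ := mem_leFinset.1 hlam
  refine ⟨lam, ?_, hx.liesOn_s h⟩
  refine Finset.eq_singleton_iff_unique_mem.2 ⟨hlam, fun μ hμ => ?_⟩
  obtain ⟨hμ, hr⟩ := mem_leFinset.1 hμ
  exact hx.eq_of_mem_lePaths h hr hl hμ

lemma liesOn_zero (x : Λ.BoundaryPath) : Λ.LiesOn (x.seg 0 0) x :=
  ⟨0, fun i => by simp, rfl⟩

/-- A graph trace is constant along each end. -/
lemma IsGraphTrace.eq_of_liesOn (hrf : Λ.RowFinite) {g : Λ.Path → ℝ} (hg : Λ.IsGraphTrace g)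
    (hx : Λ.IsEnd x) {v : Λ.Path} (h : Λ.LiesOn v x) : g v = g (x.seg 0 0) := by
  obtain ⟨p, hp, rfl⟩ := h
  have h0 := liesOn_zero x
  have hmem : x.seg 0 p ∈ leFinset hrf (x.seg 0 0) p := by
    refine mem_leFinset.2 ⟨mem_lePaths_iff.2 ?_, x.seg_r 0 p zero_le hp⟩
    rw [x.seg_d 0 p zero_le hp, tsub_zero]
    exact ⟨le_rfl, fun i hi => absurd hi (lt_irrefl _)⟩
  obtain ⟨lam, hlam, -⟩ := hx.exists_leFinset_eq_singleton hrf h0 p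
  rw [((isGraphTrace_iff hrf).1 hg).2 _ (LiesOn.isVertex h0) p]
  rw [hlam, Finset.mem_singleton] at hmem
  rw [hlam, Finset.sum_singleton, ← hmem, x.seg_s 0 p zero_le hp]

end Ends

open Classical in
/-- The value at a vertex of a function on ends: its value at some end through the vertex, and
`0` if there is no such end. -/
noncomputable def endValue (gE : Λ.BoundaryPath → ℝ) (v : Λ.Path) : ℝ :=
  if h : ∃ x, Λ.IsEnd x ∧ Λ.LiesOn v x then gE h.choose else 0

lemma endValue_eq {gE : Λ.BoundaryPath → ℝ}
    (hconst : ∀ x y, Λ.IsEnd x → Λ.IsEnd y → Λ.EndEquiv x y → gE x = gE y)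
    {x : Λ.BoundaryPath} (hx : Λ.IsEnd x) {v : Λ.Path} (h : Λ.LiesOn v x) :
    endValue gE v = gE x := by
  have hex : ∃ x, Λ.IsEnd x ∧ Λ.LiesOn v x := ⟨x, hx, h⟩
  rw [endValue, dif_pos hex]
  obtain ⟨hy, m, hm, hvm⟩ := hex.choose_spec
  obtain ⟨n, hn, hvn⟩ := h
  exact hconst _ _ hy hx ⟨m, n, hm, hn, hvm.symm.trans hvn⟩

lemma endValue_nonneg {gE : Λ.BoundaryPath → ℝ} (hnonneg : ∀ x, Λ.IsEnd x → 0 ≤ gE x)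
    (v : Λ.Path) : 0 ≤ endValue gE v := by
  rw [endValue]
  split_ifs with h
  · exact hnonneg _ h.choose_spec.1
  · exact le_rfl

lemma sum_endValue_of_liesOn (hrf : Λ.RowFinite) {gE : Λ.BoundaryPath → ℝ}
    (hconst : ∀ x y, Λ.IsEnd x → Λ.IsEnd y → Λ.EndEquiv x y → gE x = gE y)
    {x : Λ.BoundaryPath} (hx : Λ.IsEnd x) {v : Λ.Path} (h : Λ.LiesOn v x) (n : Fin k → ℕ) :
    ∑ lam ∈ leFinset hrf v n, endValue gE (Λ.s lam) = gE x := by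
  obtain ⟨lam, hlam, hs⟩ := hx.exists_leFinset_eq_singleton hrf h n
  rw [hlam, Finset.sum_singleton, endValue_eq hconst hx hs]

/-- The sum of `endValue` over `vΛ^{≤ n}` stabilises once all sources lie on ends. -/
lemma sum_endValue_eq_of_le (hrf : Λ.RowFinite) (hlc : Λ.LocallyConvex)
    {gE : Λ.BoundaryPath → ℝ}
    (hconst : ∀ x y, Λ.IsEnd x → Λ.IsEnd y → Λ.EndEquiv x y → gE x = gE y)
    {v : Λ.Path} {m n : Fin k → ℕ} (hmn : m ≤ n)
    (h : ∀ lam ∈ Λ.vLePaths v m, ∃ x, Λ.IsEnd x ∧ Λ.LiesOn (Λ.s lam) x) :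
    ∑ lam ∈ leFinset hrf v n, endValue gE (Λ.s lam) =
      ∑ lam ∈ leFinset hrf v m, endValue gE (Λ.s lam) := by
  rw [← add_tsub_cancel_of_le hmn, sum_leFinset_add hrf hlc]
  refine Finset.sum_congr rfl fun μ hμ => ?_
  obtain ⟨x, hx, hs⟩ := h μ (mem_leFinset.1 hμ)
  rw [sum_endValue_of_liesOn hrf hconst hx hs, endValue_eq hconst hx hs]

end KGraph

/-- If every vertex reaches ends within `N v` steps, then every nonnegative function
on `∼`-classes of ends extends uniquely to a graph trace on `Λ`. -/
theorem graph_trace_from_end_classes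
    {k : ℕ} (Λ : KGraph k) (hrf : Λ.RowFinite) (hlc : Λ.LocallyConvex)
    (N : Λ.Path → Fin k → ℕ)
    (hN : ∀ v : Λ.Path, Λ.IsVertex v → ∀ lam ∈ Λ.vLePaths v (N v),
      ∃ x : Λ.BoundaryPath, Λ.IsEnd x ∧ Λ.LiesOn (Λ.s lam) x)
    (gE : Λ.BoundaryPath → ℝ)
    (hnonneg : ∀ x : Λ.BoundaryPath, Λ.IsEnd x → 0 ≤ gE x)
    (hconst : ∀ x y : Λ.BoundaryPath, Λ.IsEnd x → Λ.IsEnd y → Λ.EndEquiv x y →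
      gE x = gE y) :
    ∃ g : Λ.Path → ℝ, Λ.IsGraphTrace g ∧
      (∀ x : Λ.BoundaryPath, Λ.IsEnd x → g (x.seg 0 0) = gE x) ∧
      ∀ g' : Λ.Path → ℝ, Λ.IsGraphTrace g' →
        (∀ x : Λ.BoundaryPath, Λ.IsEnd x → g' (x.seg 0 0) = gE x) →
        ∀ v : Λ.Path, Λ.IsVertex v → g' v = g v := by
  refine ⟨fun v => ∑ lam ∈ KGraph.leFinset hrf v (N v), KGraph.endValue gE (Λ.s lam),
    (KGraph.isGraphTrace_iff hrf).2 ⟨fun v _ => ?_, fun v hv n => ?_⟩, fun x hx => ?_, ?_⟩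
  · exact Finset.sum_nonneg fun lam _ => KGraph.endValue_nonneg hnonneg _
  · obtain ⟨M, hM⟩ : ∃ M, ∀ μ ∈ KGraph.leFinset hrf v n, N (Λ.s μ) ≤ M :=
      ⟨_, fun μ hμ => Finset.le_sup (f := fun μ => N (Λ.s μ)) hμ⟩
    calc _ = ∑ lam ∈ KGraph.leFinset hrf v (n + (M + N v)), KGraph.endValue gE (Λ.s lam) :=
          (KGraph.sum_endValue_eq_of_le hrf hlc hconst
            (le_add_of_nonneg_of_le zero_le (le_add_of_nonneg_left zero_le)) (hN v hv)).symm
      _ = _ := by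
          rw [KGraph.sum_leFinset_add hrf hlc]
          refine Finset.sum_congr rfl fun μ hμ => ?_
          exact KGraph.sum_endValue_eq_of_le hrf hlc hconst
            ((hM μ hμ).trans le_self_add) (hN _ (Λ.d_s μ))
  · exact KGraph.sum_endValue_of_liesOn hrf hconst hx (KGraph.liesOn_zero x) _
  · intro g' hg' hg'E v hv
    rw [((KGraph.isGraphTrace_iff hrf).1 hg').2 v hv (N v)]
    refine Finset.sum_congr rfl fun lam hlam => ?_
    obtain ⟨x, hx, hs⟩ := hN v hv lam (KGraph.mem_leFinset.1 hlam)
    rw [hg'.eq_of_liesOn hrf hx hs, hg'E x hx, KGraph.endValue_eq hconst hx hs]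
end
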